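/- arXiv:1204.4826 — 6 statements merged into one kernel-verified Lean document; each statement's English description precedes it below -/
import Mathlib

section
/- Let g ≥ 1, let H be a symmetric g×g integer matrix, and let P̃_A, P̃_B be complex g×g matrices. Assume there exists an integer symplectic matrix M₀ = [[A₀,B₀],[C₀,D₀]] ∈ Sp(2g,ℤ) such that, setting P_A := A₀·P̃_A + B₀·P̃_B and P_B := C₀·P̃_A + D₀·P̃_B, the matrix P_A has real entries and is invertible, Re(P_B) = (1/2)·H·P_A, and Im(P_B) is invertible. Set M̃ := Im(P̃_Bᵀ)·Re(P̃_A) − Im(P̃_Aᵀ)·Re(P̃_B) (which is then invertible), and let R be the 2g×2g matrix with block form R = [[(2·Re(P̃_B)·M̃⁻¹·Im(P̃_Aᵀ) + I_g)ᵀ, −2·Re(P̃_A)·M̃⁻¹·Im(P̃_Aᵀ)], [2·Re(P̃_B)·M̃⁻¹·Im(P̃_Bᵀ), −(2·Re(P̃_B)·M̃⁻¹·Im(P̃_Aᵀ) + I_g)]], which has integer entries. Let S = [S₁; S₂] be a 2g×g integer matrix (S₁, S₂ its top and bottom g×g blocks) whose columns form a ℤ-basis of the ℤ-module K_ℤ =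 {w ∈ ℤ^{2g} : Rᵀ·w = w}. Assume S₁ᵀ·Re(P̃_A) + S₂ᵀ·Re(P̃_B) is invertible, that the 2g×g real matrix G := 2·[−Re(P̃_B); Re(P̃_A)]·(S₁ᵀ·Re(P̃_A) + S₂ᵀ·Re(P̃_B))⁻¹ has integer entries, and that Q ∈ GL_g(ℤ) satisfies S·Q·H·Qᵀ ≡ G (mod 2). Define g×g matrices A, B, C, D by [Aᵀ; Bᵀ] := S·Q and [Cᵀ; Dᵀ] := (1/2)·S·Q·H + [−Re(P̃_B); Re(P̃_A)]·(S₁ᵀ·Re(P̃_A) + S₂ᵀ·Re(P̃_B))⁻¹·(Qᵀ)⁻¹. Then A, B, C, D have integer entries, the matrix M := [[A,B],[C,D]] is symplectic, it satisfies M·R = K_H·M, and setting P_A' := A·P̃_A + B·P̃_B and P_B' := C·P̃_A + D·P̃_B, the matrix P_A' has real entries and the entrywise complex conjugate of P_B' equals −P_B' + H·P_A'. -/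
open Matrix

section Helpers

set_option linter.unusedSectionVars false

variable {n : Type*} [Fintype n] [DecidableEq n]

lemma aux_re (A : Matrix n n ℤ) (P : Matrix n n ℂ) :
    (A.map (Int.cast : ℤ → ℂ) * P).map Complex.re = A.map (Int.cast : ℤ → ℝ) * P.map Complex.re := by
  ext i j
  simp [Matrix.mul_apply]

lemma aux_im (A : Matrix n n ℤ) (P : Matrix n n ℂ) :
    (A.map (Int.cast : ℤ → ℂ) * P).map Complex.im = A.map (Int.cast : ℤ → ℝ) * P.map Complex.im := by
  ext i j
  simp [Matrix.mul_apply]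

lemma aux_re_add (A B : Matrix n n ℤ) (P P' : Matrix n n ℂ) :
    (A.map (Int.cast : ℤ → ℂ) * P + B.map (Int.cast : ℤ → ℂ) * P').map Complex.re =
      A.map (Int.cast : ℤ → ℝ) * P.map Complex.re + B.map (Int.cast : ℤ → ℝ) * P'.map Complex.re := by
  rw [← aux_re, ← aux_re]; ext i j; simp

lemma aux_im_add (A B : Matrix n n ℤ) (P P' : Matrix n n ℂ) :
    (A.map (Int.cast : ℤ → ℂ) * P + B.map (Int.cast : ℤ → ℂ) * P').map Complex.im =
      A.map (Int.cast : ℤ → ℝ) * P.map Complex.im + B.map (Int.cast : ℤ → ℝ) * P'.map Complex.im := by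
  rw [← aux_im, ← aux_im]; ext i j; simp

lemma aux_cast_mul {l m k : Type*} [Fintype m] (A : Matrix l m ℤ) (B : Matrix m k ℤ) :
    (A * B).map (Int.cast : ℤ → ℝ) = A.map (Int.cast : ℤ → ℝ) * B.map (Int.cast : ℤ → ℝ) := by
  ext i j
  simp [Matrix.mul_apply]

lemma aux_cast_inj {l m : Type*} {A B : Matrix l m ℤ}
    (h : A.map (Int.cast : ℤ → ℝ) = B.map (Int.cast : ℤ → ℝ)) : A = B := by
  ext i j
  have := congrFun (congrFun h i) j
  simpa using this

lemma aux_cast_J : (fromBlocks 0 1 (-1) 0 : Matrix (n ⊕ n) (n ⊕ n) ℤ).map (Int.cast : ℤ → ℝ) =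
    fromBlocks 0 1 (-1) 0 := by
  ext i j
  rcases i with i | i <;> rcases j with j | j <;> simp [Matrix.one_apply]

lemma aux_cast_K (H : Matrix n n ℤ) :
    (fromBlocks 1 0 H (-1) : Matrix (n ⊕ n) (n ⊕ n) ℤ).map (Int.cast : ℤ → ℝ) =
    fromBlocks 1 0 (H.map (Int.cast : ℤ → ℝ)) (-1) := by
  ext i j
  rcases i with i | i <;> rcases j with j | j <;> simp [Matrix.one_apply]

lemma aux_form (X U Y V : Matrix n n ℝ) :
    (fromBlocks X U Y V)ᵀ * fromBlocks 0 1 (-1) 0 * fromBlocks X U Y V =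
      fromBlocks (Xᵀ * Y - Yᵀ * X) (Xᵀ * V - Yᵀ * U) (Uᵀ * Y - Vᵀ * X) (Uᵀ * V - Vᵀ * U) := by
  simp only [fromBlocks_transpose, fromBlocks_multiply]
  congr 1 <;> simp [sub_eq_neg_add]

/-- Symplectic relations coming from the existence of `M₀`. -/
lemma aux_relations (a b c d X U Y V H PA W : Matrix n n ℝ) (hH : Hᵀ = H)
    (hs : (fromBlocks a b c d)ᵀ * fromBlocks 0 1 (-1) 0 * fromBlocks a b c d =
      (fromBlocks 0 1 (-1) 0 : Matrix (n ⊕ n) (n ⊕ n) ℝ))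
    (h1 : a * X + b * Y = PA) (h2 : a * U + b * V = 0)
    (h3 : c * X + d * Y = (1 / 2 : ℝ) • (H * PA)) (h4 : c * U + d * V = W) :
    Xᵀ * Y = Yᵀ * X ∧ Uᵀ * V = Vᵀ * U ∧ Vᵀ * X - Uᵀ * Y = Wᵀ * PA := by
  have hN : fromBlocks a b c d * fromBlocks X U Y V =
      fromBlocks PA 0 ((1 / 2 : ℝ) • (H * PA)) W := by
    rw [fromBlocks_multiply, h1, h2, h3, h4]
  have key : (fromBlocks X U Y V)ᵀ * fromBlocks 0 1 (-1) 0 * fromBlocks X U Y V =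
      (fromBlocks PA 0 ((1 / 2 : ℝ) • (H * PA)) W)ᵀ * fromBlocks 0 1 (-1) 0 *
        fromBlocks PA 0 ((1 / 2 : ℝ) • (H * PA)) W := by
    rw [← hN, transpose_mul]
    conv_lhs => rw [← hs]
    simp only [Matrix.mul_assoc]
  rw [aux_form, aux_form, fromBlocks_inj] at key
  obtain ⟨k1, -, k3, k4⟩ := key
  refine ⟨?_, ?_, ?_⟩
  · rw [← sub_eq_zero, k1]
    simp [transpose_mul, hH, Matrix.mul_assoc]
  · rw [← sub_eq_zero, k4]; simp
  · rw [← neg_sub, k3]; simp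

lemma aux_Zunit (X U Y V Mt : Matrix n n ℝ)
    (h1 : Xᵀ * Y = Yᵀ * X) (h2 : Uᵀ * V = Vᵀ * U) (hM : Mt = Vᵀ * X - Uᵀ * Y) (hu : IsUnit Mt) :
    IsUnit (fromBlocks X U Y V) ∧ X * Mt⁻¹ * Vᵀ - U * Mt⁻¹ᵀ * Yᵀ = 1 := by
  have hd : IsUnit Mt.det := (Matrix.isUnit_iff_isUnit_det _).1 hu
  have hT : Xᵀ * V - Yᵀ * U = Mtᵀ := by rw [hM]; simp [transpose_mul]
  have hN : Uᵀ * Y - Vᵀ * X = - Mt := by rw [hM]; simp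
  have hi : Mt⁻¹ * Mt = 1 := nonsing_inv_mul _ hd
  have hi' : Mt⁻¹ᵀ * Mtᵀ = 1 := by
    rw [← transpose_mul, mul_nonsing_inv _ hd, transpose_one]
  have hL : (fromBlocks 0 (-Mt⁻¹) Mt⁻¹ᵀ 0 * ((fromBlocks X U Y V)ᵀ * fromBlocks 0 1 (-1) 0)) *
      fromBlocks X U Y V = 1 := by
    rw [Matrix.mul_assoc, aux_form, fromBlocks_multiply, h1, h2, hT, hN, ← fromBlocks_one]
    congr 1 <;> simp [hi, hi']
  have hR := mul_eq_one_comm.1 hL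
  refine ⟨(Matrix.isUnit_iff_isUnit_det _).2 (isUnit_det_of_left_inverse hL), ?_⟩
  rw [fromBlocks_transpose, fromBlocks_multiply, fromBlocks_multiply, fromBlocks_multiply,
    ← fromBlocks_one, fromBlocks_inj] at hR
  have := hR.1
  simp only [Matrix.zero_mul, Matrix.mul_zero, Matrix.mul_one, Matrix.mul_neg, Matrix.neg_mul, neg_neg,
    zero_add, add_zero] at this
  rw [← this, Matrix.mul_assoc, Matrix.mul_assoc]
  simp [sub_eq_add_neg]

lemma aux_RZ (X U Y V Mt : Matrix n n ℝ)
    (h1 : Xᵀ * Y = Yᵀ * X) (h2 : Uᵀ * V = Vᵀ * U) (hM : Mt = Vᵀ * X - Uᵀ * Y) (hu : IsUnit Mt) :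
    fromBlocks (((2 : ℝ) • (Y * Mt⁻¹ * Uᵀ) + 1)ᵀ) (-((2 : ℝ) • (X * Mt⁻¹ * Uᵀ)))
      ((2 : ℝ) • (Y * Mt⁻¹ * Vᵀ)) (-((2 : ℝ) • (Y * Mt⁻¹ * Uᵀ) + 1)) * fromBlocks X U Y V =
    fromBlocks X (-U) Y (-V) := by
  have hd : IsUnit Mt.det := (Matrix.isUnit_iff_isUnit_det _).1 hu
  have hi : Mt⁻¹ * Mt = 1 := nonsing_inv_mul _ hd
  have e := (aux_Zunit X U Y V Mt h1 h2 hM hu).2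
  have e1 : ((2 : ℝ) • (Y * Mt⁻¹ * Uᵀ) + 1)ᵀ = (2 : ℝ) • (X * Mt⁻¹ * Vᵀ) - 1 := by
    have e2 : (Y * Mt⁻¹ * Uᵀ)ᵀ = X * Mt⁻¹ * Vᵀ - 1 := by
      rw [← e]; simp [transpose_mul, Matrix.mul_assoc]
    rw [transpose_add, transpose_smul, e2, transpose_one]
    module
  have p1 : ∀ T : Matrix n n ℝ, T * Mt⁻¹ * Vᵀ * X - T * Mt⁻¹ * Uᵀ * Y = T := fun T => by
    have : T * Mt⁻¹ * Vᵀ * X - T * Mt⁻¹ * Uᵀ * Y = T * (Mt⁻¹ * Mt) := by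
      rw [hM]; simp only [Matrix.mul_assoc, Matrix.mul_sub]
    rw [this, hi, Matrix.mul_one]
  have p2 : ∀ T : Matrix n n ℝ, T * Mt⁻¹ * Vᵀ * U - T * Mt⁻¹ * Uᵀ * V = 0 := fun T => by
    simp only [Matrix.mul_assoc, h2, sub_self]
  rw [e1, fromBlocks_multiply]
  simp only [Matrix.sub_mul, Matrix.add_mul, Matrix.neg_mul, Matrix.smul_mul, Matrix.one_mul]
  congr 1
  · linear_combination (norm := module) (2 : ℝ) • p1 X
  · linear_combination (norm := module) (2 : ℝ) • p2 X
  · linear_combination (norm := module) (2 : ℝ) • p1 Y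
  · linear_combination (norm := module) (2 : ℝ) • p2 Y

/-- The real-matrix core of the theorem. -/
lemma aux_core (X U Y V Mt a b c d H PA W : Matrix n n ℝ) (R : Matrix (n ⊕ n) (n ⊕ n) ℝ)
    (h1 : Xᵀ * Y = Yᵀ * X) (h2 : Uᵀ * V = Vᵀ * U) (hM : Mt = Vᵀ * X - Uᵀ * Y) (hH : Hᵀ = H)
    (hZ : IsUnit (fromBlocks X U Y V))
    (hRZ : R * fromBlocks X U Y V = fromBlocks X (-U) Y (-V))
    (k1 : a * X + b * Y = PA) (k2 : a * U + b * V = 0)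
    (k3 : c * X + d * Y = (1 / 2 : ℝ) • (H * PA)) (k4 : c * U + d * V = W)
    (k5 : PAᵀ * W = Mtᵀ) :
    (fromBlocks a b c d)ᵀ * fromBlocks 0 1 (-1) 0 * fromBlocks a b c d =
      (fromBlocks 0 1 (-1) 0 : Matrix (n ⊕ n) (n ⊕ n) ℝ) ∧
    fromBlocks a b c d * R = fromBlocks 1 0 H (-1) * fromBlocks a b c d := by
  have hN : fromBlocks a b c d * fromBlocks X U Y V =
      fromBlocks PA 0 ((1 / 2 : ℝ) • (H * PA)) W := by
    rw [fromBlocks_multiply, k1, k2, k3, k4]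
  have k5' : Wᵀ * PA = Mt := by
    have := congrArg transpose k5
    simpa [transpose_mul] using this
  constructor
  · have hZt : IsUnit (fromBlocks X U Y V)ᵀ := by
      rw [Matrix.isUnit_iff_isUnit_det, det_transpose, ← Matrix.isUnit_iff_isUnit_det]; exact hZ
    apply hZ.mul_right_cancel
    apply hZt.mul_left_cancel
    have l : (fromBlocks X U Y V)ᵀ * ((fromBlocks a b c d)ᵀ * fromBlocks 0 1 (-1) 0 *
        fromBlocks a b c d * fromBlocks X U Y V) =
        (fromBlocks a b c d * fromBlocks X U Y V)ᵀ * fromBlocks 0 1 (-1) 0 *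
        (fromBlocks a b c d * fromBlocks X U Y V) := by
      rw [transpose_mul]; simp only [Matrix.mul_assoc]
    rw [l, hN, aux_form, ← Matrix.mul_assoc, aux_form, h1, h2]
    congr 1
    · simp [transpose_mul, hH, Matrix.mul_assoc]
    · rw [k5, hM]; simp [transpose_mul]
    · simp [k5', hM]
    · simp
  · apply hZ.mul_right_cancel
    rw [Matrix.mul_assoc, hRZ, Matrix.mul_assoc, hN, fromBlocks_multiply, fromBlocks_multiply]
    simp only [Matrix.mul_neg, ← neg_add, k1, k2, k3, k4]
    congr 1
    · simp
    · simp
    · simp only [Matrix.neg_mul, Matrix.one_mul]; module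
    · simp

/-- Integrality of `[Cᵀ; Dᵀ]`. -/
lemma aux_integral (S G : Matrix (n ⊕ n) n ℤ) (Q H : Matrix n n ℤ) (hQ : IsUnit Q.det)
    (hcong : ∀ i j, (2 : ℤ) ∣ ((S * Q * H * Qᵀ) i j - G i j))
    (L : Matrix (n ⊕ n) n ℝ) (hG : G.map (Int.cast : ℤ → ℝ) = (2 : ℝ) • L)
    (Cr Dr : Matrix n n ℝ)
    (hCD : Matrix.fromRows Crᵀ Drᵀ =
      (1 / 2 : ℝ) • ((S * Q).map (Int.cast : ℤ → ℝ) * H.map (Int.cast : ℤ → ℝ)) +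
      L * ((Q.map (Int.cast : ℤ → ℝ))ᵀ)⁻¹) :
    ∃ C D : Matrix n n ℤ, C.map (Int.cast : ℤ → ℝ) = Cr ∧ D.map (Int.cast : ℤ → ℝ) = Dr := by
  choose e he using hcong
  have hE : (S * Q * H * Qᵀ) = (2 : ℤ) • (Matrix.of e) + G := by
    ext i j
    have := he i j
    simp only [Matrix.add_apply, Matrix.smul_apply, Matrix.of_apply, smul_eq_mul]
    linarith
  have hE' : (S * Q).map (Int.cast : ℤ → ℝ) * H.map (Int.cast : ℤ → ℝ) *
      (Q.map (Int.cast : ℤ → ℝ))ᵀ =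
      (2 : ℝ) • (Matrix.of e).map (Int.cast : ℤ → ℝ) + (2 : ℝ) • L := by
    rw [← hG, ← transpose_map, ← aux_cast_mul, ← aux_cast_mul, hE]
    ext i j
    simp
  have hQi : (Q.map (Int.cast : ℤ → ℝ))ᵀ * ((Q⁻¹).map (Int.cast : ℤ → ℝ))ᵀ = 1 := by
    rw [← transpose_mul, ← aux_cast_mul, nonsing_inv_mul _ hQ]
    ext i j
    simp [Matrix.one_apply, eq_comm]
  have hQinv : ((Q.map (Int.cast : ℤ → ℝ))ᵀ)⁻¹ = ((Q⁻¹).map (Int.cast : ℤ → ℝ))ᵀ :=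
    inv_eq_right_inv hQi
  have hF : Matrix.fromRows Crᵀ Drᵀ = ((Matrix.of e + G) * (Q⁻¹)ᵀ).map (Int.cast : ℤ → ℝ) := by
    have e3 : (S * Q).map (Int.cast : ℤ → ℝ) * H.map (Int.cast : ℤ → ℝ) =
        ((2 : ℝ) • (Matrix.of e).map (Int.cast : ℤ → ℝ) + (2 : ℝ) • L) *
          ((Q⁻¹).map (Int.cast : ℤ → ℝ))ᵀ := by
      rw [← hE', Matrix.mul_assoc, hQi, Matrix.mul_one]
    have e4 : (Matrix.of e + G).map (Int.cast : ℤ → ℝ) =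
        (Matrix.of e).map (Int.cast : ℤ → ℝ) + (2 : ℝ) • L := by
      rw [← hG]; ext i j; simp
    rw [hCD, e3, hQinv, aux_cast_mul, transpose_map, e4]
    simp only [Matrix.add_mul, Matrix.smul_mul]
    module
  refine ⟨(((Matrix.of e + G) * (Q⁻¹)ᵀ).toRows₁)ᵀ, (((Matrix.of e + G) * (Q⁻¹)ᵀ).toRows₂)ᵀ, ?_, ?_⟩
  · ext i j
    have := congrFun (congrFun hF (Sum.inl j)) i
    simpa using this.symm
  · ext i j
    have := congrFun (congrFun hF (Sum.inr j)) i
    simpa using this.symm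

/-- Real formulas for the transformed periods. -/
lemma aux_transform (X U Y V Mt s₁ s₂ q a b c d H T : Matrix n n ℝ) (hH : Hᵀ = H)
    (h1 : Xᵀ * Y = Yᵀ * X) (hM : Mt = Vᵀ * X - Uᵀ * Y)
    (hT : T = s₁ᵀ * X + s₂ᵀ * Y) (hTu : IsUnit T) (hq : IsUnit q)
    (ha : a = qᵀ * s₁ᵀ) (hb : b = qᵀ * s₂ᵀ)
    (hsw : s₁ᵀ * U + s₂ᵀ * V = 0)
    (hc : cᵀ = (1 / 2 : ℝ) • (aᵀ * H) + -Y * T⁻¹ * (qᵀ)⁻¹)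
    (hd : dᵀ = (1 / 2 : ℝ) • (bᵀ * H) + X * T⁻¹ * (qᵀ)⁻¹) :
    a * U + b * V = 0 ∧
    c * X + d * Y = (1 / 2 : ℝ) • (H * (a * X + b * Y)) ∧
    (a * X + b * Y)ᵀ * (c * U + d * V) = Mtᵀ := by
  have hTd : IsUnit T.det := (Matrix.isUnit_iff_isUnit_det _).1 hTu
  have hqd : IsUnit q.det := (Matrix.isUnit_iff_isUnit_det _).1 hq
  have hp : a * X + b * Y = qᵀ * T := by
    rw [ha, hb, hT]; simp only [Matrix.mul_add, Matrix.mul_assoc]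
  have hz : a * U + b * V = 0 := by
    have : a * U + b * V = qᵀ * (s₁ᵀ * U + s₂ᵀ * V) := by
      rw [ha, hb]; simp only [Matrix.mul_add, Matrix.mul_assoc]
    rw [this, hsw, Matrix.mul_zero]
  have hc' : c = (1 / 2 : ℝ) • (H * a) - q⁻¹ * (T⁻¹)ᵀ * Yᵀ := by
    rw [← transpose_transpose c, hc]
    simp [transpose_mul, hH, Matrix.mul_assoc, transpose_nonsing_inv, sub_eq_add_neg]
  have hd' : d = (1 / 2 : ℝ) • (H * b) + q⁻¹ * (T⁻¹)ᵀ * Xᵀ := by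
    rw [← transpose_transpose d, hd]
    simp [transpose_mul, hH, Matrix.mul_assoc, transpose_nonsing_inv]
  refine ⟨hz, ?_, ?_⟩
  · have : c * X + d * Y = (1 / 2 : ℝ) • (H * (a * X + b * Y)) +
        q⁻¹ * (T⁻¹)ᵀ * (Xᵀ * Y - Yᵀ * X) := by
      rw [hc', hd']
      simp only [Matrix.mul_add, Matrix.mul_sub, Matrix.add_mul, Matrix.sub_mul, Matrix.smul_mul,
        Matrix.mul_assoc]
      module
    rw [this, h1, sub_self, Matrix.mul_zero, add_zero]
  · have : c * U + d * V = (1 / 2 : ℝ) • (H * (a * U + b * V)) +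
        q⁻¹ * (T⁻¹)ᵀ * (Xᵀ * V - Yᵀ * U) := by
      rw [hc', hd']
      simp only [Matrix.mul_add, Matrix.mul_sub, Matrix.add_mul, Matrix.sub_mul, Matrix.smul_mul,
        Matrix.mul_assoc]
      module
    have hm : Xᵀ * V - Yᵀ * U = Mtᵀ := by rw [hM]; simp [transpose_mul]
    rw [this, hz, Matrix.mul_zero, smul_zero, zero_add, hp, hm, transpose_mul, transpose_transpose]
    have e1 : q * q⁻¹ = 1 := mul_nonsing_inv _ hqd
    have e2 : Tᵀ * (T⁻¹)ᵀ = 1 := by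
      rw [← transpose_mul, nonsing_inv_mul _ hTd, transpose_one]
    calc Tᵀ * q * (q⁻¹ * (T⁻¹)ᵀ * Mtᵀ) = Tᵀ * (q * q⁻¹) * (T⁻¹)ᵀ * Mtᵀ := by
          simp only [Matrix.mul_assoc]
      _ = Mtᵀ := by rw [e1, Matrix.mul_one, e2, Matrix.one_mul]

lemma aux_Sw (s₁ s₂ X U Y V : Matrix n n ℝ) (R : Matrix (n ⊕ n) (n ⊕ n) ℝ)
    (hRS : Rᵀ * fromRows s₁ s₂ = fromRows s₁ s₂)
    (hRZ : R * fromBlocks X U Y V = fromBlocks X (-U) Y (-V)) :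
    s₁ᵀ * U + s₂ᵀ * V = 0 := by
  have h : fromCols s₁ᵀ s₂ᵀ * R = fromCols s₁ᵀ s₂ᵀ := by
    have := congrArg transpose hRS
    simpa [transpose_mul, transpose_fromRows] using this
  have h2 : fromCols s₁ᵀ s₂ᵀ * fromBlocks X U Y V = fromCols s₁ᵀ s₂ᵀ * fromBlocks X (-U) Y (-V) := by
    rw [← hRZ, ← Matrix.mul_assoc, h]
  rw [fromCols_mul_fromBlocks, fromCols_mul_fromBlocks] at h2
  have h3 := (fromCols_inj h2).2
  simp only [Matrix.mul_neg, ← neg_add] at h3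
  ext i j
  have h4 := congrFun (congrFun h3 i) j
  rw [Matrix.neg_apply] at h4
  rw [Matrix.zero_apply]
  linarith

end Helpers

/-- main theorem (Theorem 3.6 of the paper). Given a symmetric
integer matrix H and complex period matrices P̃_A, P̃_B that can be brought by
some integer symplectic matrix M₀ to a symmetric form (P_A real and
invertible, Re(P_B) = (1/2)·H·P_A, Im(P_B) invertible), let R be the integer
matrix given by the explicit block formula in terms of
M̃ = Im(P̃_Bᵀ)·Re(P̃_A) − Im(P̃_Aᵀ)·Re(P̃_B), let the columns of S = [S₁;S₂] be a
ℤ-basis of K_ℤ = {w ∈ ℤ^{2g} : Rᵀw = w}, assume S₁ᵀ·Re(P̃_A) + S₂ᵀ·Re(P̃_B) is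
invertible, that G := 2·[−Re(P̃_B);Re(P̃_A)]·(S₁ᵀRe(P̃_A)+S₂ᵀRe(P̃_B))⁻¹ has
integer entries, and that Q ∈ GL_g(ℤ) satisfies S·Q·H·Qᵀ ≡ G (mod 2). Define
A, B by [Aᵀ;Bᵀ] = S·Q and C, D by the formula
[Cᵀ;Dᵀ] = (1/2)·S·Q·H + [−Re(P̃_B);Re(P̃_A)]·(S₁ᵀRe(P̃_A)+S₂ᵀRe(P̃_B))⁻¹·(Qᵀ)⁻¹.
Then C, D have integer entries, M = [[A,B],[C,D]] is symplectic, M·R = K_H·M,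
and P_A' := A·P̃_A + B·P̃_B is real while P_B' := C·P̃_A + D·P̃_B satisfies
conj(P_B') = −P_B' + H·P_A'. -/
theorem stmt_0 (g : ℕ) (hg : 1 ≤ g)
    (H : Matrix (Fin g) (Fin g) ℤ) (hH : Hᵀ = H)
    (PtA PtB : Matrix (Fin g) (Fin g) ℂ)
    (hsym : ∃ A₀ B₀ C₀ D₀ : Matrix (Fin g) (Fin g) ℤ,
      (Matrix.fromBlocks A₀ B₀ C₀ D₀)ᵀ * Matrix.fromBlocks 0 1 (-1) 0 *
          Matrix.fromBlocks A₀ B₀ C₀ D₀ = (Matrix.fromBlocks 0 1 (-1) 0 :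
          Matrix (Fin g ⊕ Fin g) (Fin g ⊕ Fin g) ℤ) ∧
      (∀ i j, (((A₀.map (Int.cast : ℤ → ℂ) * PtA + B₀.map (Int.cast : ℤ → ℂ) * PtB)) i j).im = 0) ∧
      IsUnit (A₀.map (Int.cast : ℤ → ℂ) * PtA + B₀.map (Int.cast : ℤ → ℂ) * PtB) ∧
      (C₀.map (Int.cast : ℤ → ℂ) * PtA + D₀.map (Int.cast : ℤ → ℂ) * PtB).map Complex.re =
        (1 / 2 : ℝ) • (H.map (Int.cast : ℤ → ℝ) *
          (A₀.map (Int.cast : ℤ → ℂ) * PtA + B₀.map (Int.cast : ℤ → ℂ) * PtB).map Complex.re) ∧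
      IsUnit ((C₀.map (Int.cast : ℤ → ℂ) * PtA + D₀.map (Int.cast : ℤ → ℂ) * PtB).map Complex.im))
    (Mt : Matrix (Fin g) (Fin g) ℝ)
    (hMt : Mt = (PtBᵀ).map Complex.im * PtA.map Complex.re -
      (PtAᵀ).map Complex.im * PtB.map Complex.re)
    (R : Matrix (Fin g ⊕ Fin g) (Fin g ⊕ Fin g) ℤ)
    (hR : R.map (Int.cast : ℤ → ℝ) = Matrix.fromBlocks
      (((2 : ℝ) • (PtB.map Complex.re * Mt⁻¹ * (PtAᵀ).map Complex.im) + 1)ᵀ)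
      (-((2 : ℝ) • (PtA.map Complex.re * Mt⁻¹ * (PtAᵀ).map Complex.im)))
      ((2 : ℝ) • (PtB.map Complex.re * Mt⁻¹ * (PtBᵀ).map Complex.im))
      (-((2 : ℝ) • (PtB.map Complex.re * Mt⁻¹ * (PtAᵀ).map Complex.im) + 1)))
    (S : Matrix (Fin g ⊕ Fin g) (Fin g) ℤ)
    (hSind : LinearIndependent ℤ (fun k : Fin g => fun i : Fin g ⊕ Fin g => S i k))
    (hSspan : Submodule.span ℤ (Set.range fun k : Fin g => fun i : Fin g ⊕ Fin g => S i k) =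
      LinearMap.ker (Matrix.mulVecLin (Rᵀ - 1)))
    (S₁ S₂ : Matrix (Fin g) (Fin g) ℤ) (hS : S = Matrix.fromRows S₁ S₂)
    (hinv : IsUnit ((S₁.map (Int.cast : ℤ → ℝ))ᵀ * PtA.map Complex.re +
      (S₂.map (Int.cast : ℤ → ℝ))ᵀ * PtB.map Complex.re))
    (G : Matrix (Fin g ⊕ Fin g) (Fin g) ℤ)
    (hG : G.map (Int.cast : ℤ → ℝ) = (2 : ℝ) •
      (Matrix.fromRows (-(PtB.map Complex.re)) (PtA.map Complex.re) *
        ((S₁.map (Int.cast : ℤ → ℝ))ᵀ * PtA.map Complex.re +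
          (S₂.map (Int.cast : ℤ → ℝ))ᵀ * PtB.map Complex.re)⁻¹))
    (Q : Matrix (Fin g) (Fin g) ℤ) (hQ : IsUnit Q.det)
    (hcong : ∀ i j, (2 : ℤ) ∣ ((S * Q * H * Qᵀ) i j - G i j))
    (A B : Matrix (Fin g) (Fin g) ℤ) (hAB : S * Q = Matrix.fromRows Aᵀ Bᵀ)
    (Cr Dr : Matrix (Fin g) (Fin g) ℝ)
    (hCD : Matrix.fromRows Crᵀ Drᵀ =
      (1 / 2 : ℝ) • ((S * Q).map (Int.cast : ℤ → ℝ) * H.map (Int.cast : ℤ → ℝ)) +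
      Matrix.fromRows (-(PtB.map Complex.re)) (PtA.map Complex.re) *
        ((S₁.map (Int.cast : ℤ → ℝ))ᵀ * PtA.map Complex.re +
          (S₂.map (Int.cast : ℤ → ℝ))ᵀ * PtB.map Complex.re)⁻¹ *
        ((Q.map (Int.cast : ℤ → ℝ))ᵀ)⁻¹) :
    ∃ C D : Matrix (Fin g) (Fin g) ℤ,
      C.map (Int.cast : ℤ → ℝ) = Cr ∧
      D.map (Int.cast : ℤ → ℝ) = Dr ∧
      (Matrix.fromBlocks A B C D)ᵀ * Matrix.fromBlocks 0 1 (-1) 0 *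
          Matrix.fromBlocks A B C D = (Matrix.fromBlocks 0 1 (-1) 0 :
          Matrix (Fin g ⊕ Fin g) (Fin g ⊕ Fin g) ℤ) ∧
      Matrix.fromBlocks A B C D * R =
        Matrix.fromBlocks 1 0 H (-1) * Matrix.fromBlocks A B C D ∧
      (∀ i j, (((A.map (Int.cast : ℤ → ℂ) * PtA + B.map (Int.cast : ℤ → ℂ) * PtB)) i j).im = 0) ∧
      (C.map (Int.cast : ℤ → ℂ) * PtA + D.map (Int.cast : ℤ → ℂ) * PtB).map (starRingEnd ℂ) =
        -(C.map (Int.cast : ℤ → ℂ) * PtA + D.map (Int.cast : ℤ → ℂ) * PtB) +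
          H.map (Int.cast : ℤ → ℂ) *
            (A.map (Int.cast : ℤ → ℂ) * PtA + B.map (Int.cast : ℤ → ℂ) * PtB) := by
  obtain ⟨A₀, B₀, C₀, D₀, hs, him, hPAu, hre, hWu⟩ := hsym
  -- real parts of the data
  have hBt : (PtBᵀ).map Complex.im = (PtB.map Complex.im)ᵀ := rfl
  have hAt : (PtAᵀ).map Complex.im = (PtA.map Complex.im)ᵀ := rfl
  rw [hBt, hAt] at hMt
  rw [hBt, hAt] at hR
  rw [aux_re_add, aux_re_add] at hre
  rw [aux_im_add] at hWu
  have him' : A₀.map (Int.cast : ℤ → ℝ) * PtA.map Complex.im +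
      B₀.map (Int.cast : ℤ → ℝ) * PtB.map Complex.im = 0 := by
    rw [← aux_im_add]; ext i j; exact him i j
  have hPAr : IsUnit (A₀.map (Int.cast : ℤ → ℝ) * PtA.map Complex.re +
      B₀.map (Int.cast : ℤ → ℝ) * PtB.map Complex.re) := by
    rw [← aux_re_add]
    set P := A₀.map (Int.cast : ℤ → ℂ) * PtA + B₀.map (Int.cast : ℤ → ℂ) * PtB with hP
    have hPP : P = (P.map Complex.re).map Complex.ofRealHom := by
      ext i j
      apply Complex.ext
      · simp
      · simpa using him i j
    rw [hPP, Matrix.isUnit_iff_isUnit_det] at hPAu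
    have : (((P.map Complex.re).map Complex.ofRealHom).det) = Complex.ofRealHom (P.map Complex.re).det := by
      rw [RingHom.map_det]; rfl
    rw [this] at hPAu
    rw [Matrix.isUnit_iff_isUnit_det]
    rw [isUnit_iff_ne_zero] at hPAu ⊢
    intro h0
    exact hPAu (by rw [h0, map_zero])
  have hHr : (H.map (Int.cast : ℤ → ℝ))ᵀ = H.map (Int.cast : ℤ → ℝ) := by
    rw [← Matrix.transpose_map, hH]
  have hs' := congrArg (fun M => M.map (Int.cast : ℤ → ℝ)) hs
  simp only [aux_cast_mul, aux_cast_J, transpose_map] at hs'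
  rw [fromBlocks_map] at hs'
  obtain ⟨r1, r2, r3⟩ := aux_relations _ _ _ _ _ _ _ _ _ _ _ hHr hs' rfl him' hre rfl
  clear hs hs' him hPAu
  have hMtu : IsUnit Mt := by
    rw [hMt, r3]
    refine IsUnit.mul ?_ hPAr
    rw [Matrix.isUnit_iff_isUnit_det, det_transpose, ← Matrix.isUnit_iff_isUnit_det]
    exact hWu
  clear r3 hre hWu him' hPAr A₀ B₀ C₀ D₀
  have hRZ := aux_RZ _ _ _ _ _ r1 r2 hMt hMtu
  rw [← hR] at hRZ
  have hZ := (aux_Zunit _ _ _ _ _ r1 r2 hMt hMtu).1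
  have hRS : Rᵀ * S = S := by
    have hk : ∀ k : Fin g, (Rᵀ - 1) *ᵥ (fun i => S i k) = 0 := fun k => by
      have : (fun i => S i k) ∈ LinearMap.ker (Matrix.mulVecLin (Rᵀ - 1)) := by
        rw [← hSspan]; exact Submodule.subset_span ⟨k, rfl⟩
      exact this
    rw [← sub_eq_zero]
    ext i k
    have := congrFun (hk k) i
    rw [Matrix.sub_mulVec, Matrix.one_mulVec] at this
    exact this
  -- `A`, `B` in terms of `S`, `Q`
  obtain ⟨C, D, hC, hD⟩ := aux_integral S G Q H hQ hcong _ hG Cr Dr hCD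
  refine ⟨C, D, hC, hD, ?_⟩
  have hQr : IsUnit (Q.map (Int.cast : ℤ → ℝ)) := by
    rw [Matrix.isUnit_iff_isUnit_det]
    have : (Q.map (Int.cast : ℤ → ℝ)).det = Int.castRingHom ℝ Q.det := by
      rw [RingHom.map_det]; rfl
    rw [this]
    exact hQ.map _
  rw [hAB, ← hC, ← hD] at hCD
  rw [hS, fromRows_mul] at hAB
  obtain ⟨e1, e2⟩ := fromRows_inj hAB
  have hA : A.map (Int.cast : ℤ → ℝ) =
      (Q.map (Int.cast : ℤ → ℝ))ᵀ * (S₁.map (Int.cast : ℤ → ℝ))ᵀ := by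
    rw [← transpose_mul, ← aux_cast_mul, e1]; rfl
  have hB : B.map (Int.cast : ℤ → ℝ) =
      (Q.map (Int.cast : ℤ → ℝ))ᵀ * (S₂.map (Int.cast : ℤ → ℝ))ᵀ := by
    rw [← transpose_mul, ← aux_cast_mul, e2]; rfl
  have hm : (fromRows Aᵀ Bᵀ).map (Int.cast : ℤ → ℝ) =
      fromRows (A.map (Int.cast : ℤ → ℝ))ᵀ (B.map (Int.cast : ℤ → ℝ))ᵀ := by
    ext i j; rcases i with i | i <;> rfl
  rw [hm, fromRows_mul, fromRows_mul, fromRows_mul] at hCD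
  have hc : (C.map (Int.cast : ℤ → ℝ))ᵀ = (1 / 2 : ℝ) • ((A.map (Int.cast : ℤ → ℝ))ᵀ *
      H.map (Int.cast : ℤ → ℝ)) + -PtB.map Complex.re * ((S₁.map (Int.cast : ℤ → ℝ))ᵀ * PtA.map Complex.re +
        (S₂.map (Int.cast : ℤ → ℝ))ᵀ * PtB.map Complex.re)⁻¹ * ((Q.map (Int.cast : ℤ → ℝ))ᵀ)⁻¹ := by
    ext i j; exact congrFun (congrFun hCD (Sum.inl i)) j
  have hd : (D.map (Int.cast : ℤ → ℝ))ᵀ = (1 / 2 : ℝ) • ((B.map (Int.cast : ℤ → ℝ))ᵀ *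
      H.map (Int.cast : ℤ → ℝ)) + PtA.map Complex.re * ((S₁.map (Int.cast : ℤ → ℝ))ᵀ * PtA.map Complex.re +
        (S₂.map (Int.cast : ℤ → ℝ))ᵀ * PtB.map Complex.re)⁻¹ * ((Q.map (Int.cast : ℤ → ℝ))ᵀ)⁻¹ := by
    ext i j; exact congrFun (congrFun hCD (Sum.inr i)) j
  have hRSr : (R.map (Int.cast : ℤ → ℝ))ᵀ *
      fromRows (S₁.map (Int.cast : ℤ → ℝ)) (S₂.map (Int.cast : ℤ → ℝ)) =
      fromRows (S₁.map (Int.cast : ℤ → ℝ)) (S₂.map (Int.cast : ℤ → ℝ)) := by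
    have hm2 : (fromRows S₁ S₂).map (Int.cast : ℤ → ℝ) =
        fromRows (S₁.map (Int.cast : ℤ → ℝ)) (S₂.map (Int.cast : ℤ → ℝ)) := by
      ext i j; rcases i with i | i <;> rfl
    rw [← hm2, ← hS, ← transpose_map, ← aux_cast_mul, hRS]
  have hsw := aux_Sw _ _ _ _ _ _ _ hRSr hRZ
  obtain ⟨t1, t2, t3⟩ := aux_transform _ _ _ _ _ _ _ _ _ _ _ _ _ _ hHr r1 hMt rfl hinv hQr hA hB
    hsw hc hd
  obtain ⟨f1, f2⟩ := aux_core _ _ _ _ _ _ _ _ _ _ _ _ _ r1 r2 hMt hHr hZ hRZ rfl t1 t2 rfl t3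
  refine ⟨?_, ?_, ?_, ?_⟩
  · apply aux_cast_inj
    rw [aux_cast_mul, aux_cast_mul, transpose_map, aux_cast_J, fromBlocks_map]
    exact f1
  · apply aux_cast_inj
    rw [aux_cast_mul, aux_cast_mul, aux_cast_K, fromBlocks_map]
    exact f2
  · intro i j
    rw [← aux_im_add] at t1
    exact congrFun (congrFun t1 i) j
  · have hPr := aux_re_add A B PtA PtB
    have hPi := aux_im_add A B PtA PtB
    have hNr := aux_re_add C D PtA PtB
    rw [t1] at hPi
    rw [t2, ← hPr] at hNr
    generalize A.map (Int.cast : ℤ → ℂ) * PtA + B.map (Int.cast : ℤ → ℂ) * PtB = P at *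
    generalize C.map (Int.cast : ℤ → ℂ) * PtA + D.map (Int.cast : ℤ → ℂ) * PtB = N at *
    have hHi : (H.map (Int.cast : ℤ → ℂ) * P).map Complex.im = 0 := by
      rw [aux_im, hPi, Matrix.mul_zero]
    rw [← aux_re] at hNr
    ext i j
    have u1 := congrFun (congrFun hHi i) j
    have u2 := congrFun (congrFun hNr i) j
    simp only [Matrix.map_apply, Matrix.smul_apply, Matrix.zero_apply, smul_eq_mul] at u1 u2
    apply Complex.ext
    · simp only [Matrix.map_apply, Matrix.add_apply, Matrix.neg_apply, Complex.conj_re,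
        Complex.add_re, Complex.neg_re]
      linarith
    · simp only [Matrix.map_apply, Matrix.add_apply, Matrix.neg_apply, Complex.conj_im,
        Complex.add_im, Complex.neg_im]
      linarith
end

section
/- Let g ≥ 1, let H be a symmetric g×g integer matrix, let M = [[A,B],[C,D]] ∈ Sp(2g,ℤ), and let P̃_A, P̃_B be complex g×g matrices. Set P_A := A·P̃_A + B·P̃_B and P_B := C·P̃_A + D·P̃_B, and assume that P_A has real entries and is invertible, that Re(P_B) = (1/2)·H·P_A, and that Im(P_B) is invertible. Then the g×g real matrix M̃ := Im(P̃_Bᵀ)·Re(P̃_A) − Im(P̃_Aᵀ)·Re(P̃_B) is invertible, and the matrix R := M⁻¹·K_H·M is given explicitly by the block formula R = [[(2·Re(P̃_B)·M̃⁻¹·Im(P̃_Aᵀ) + I_g)ᵀ, −2·Re(P̃_A)·M̃⁻¹·Im(P̃_Aᵀ)], [2·Re(P̃_B)·M̃⁻¹·Im(P̃_Bᵀ), −(2·Re(P̃_B)·M̃⁻¹·Im(P̃_Aᵀ) + I_g)]]. -/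
open Matrix

theorem aux_core_s1 {g : ℕ} (H A B C D XA XB YA YB p Q Mt : Matrix (Fin g) (Fin g) ℝ)
    (hH : Hᵀ = H)
    (hsymp : (fromBlocks A B C D)ᵀ * fromBlocks 0 1 (-1) 0 * fromBlocks A B C D =
      (fromBlocks 0 1 (-1) 0 : Matrix (Fin g ⊕ Fin g) (Fin g ⊕ Fin g) ℝ))
    (h1 : A * XA + B * XB = p) (h2 : A * YA + B * YB = 0)
    (h3 : C * XA + D * XB = (1 / 2 : ℝ) • (H * p)) (h4 : C * YA + D * YB = Q)
    (hp : IsUnit p) (hQ : IsUnit Q) (hMt : Mt = YBᵀ * XA - YAᵀ * XB) :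
    IsUnit Mt ∧
    (fromBlocks A B C D)⁻¹ * fromBlocks 1 0 H (-1) * fromBlocks A B C D =
      fromBlocks (((2 : ℝ) • (XB * Mt⁻¹ * YAᵀ) + 1)ᵀ) (-((2 : ℝ) • (XA * Mt⁻¹ * YAᵀ)))
        ((2 : ℝ) • (XB * Mt⁻¹ * YBᵀ)) (-((2 : ℝ) • (XB * Mt⁻¹ * YAᵀ) + 1)) := by
  set M := fromBlocks A B C D with hM
  set J : Matrix (Fin g ⊕ Fin g) (Fin g ⊕ Fin g) ℝ := fromBlocks 0 1 (-1) 0 with hJ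
  set K : Matrix (Fin g ⊕ Fin g) (Fin g ⊕ Fin g) ℝ := fromBlocks 1 0 H (-1) with hK
  set W := fromBlocks XA YA XB YB with hW
  have hMW : M * W = fromBlocks p 0 ((1 / 2 : ℝ) • (H * p)) Q := by
    rw [hM, hW, fromBlocks_multiply, h1, h2, h3, h4]
  have hWJ : Wᵀ * J * W = (M * W)ᵀ * J * (M * W) := by
    nth_rewrite 1 [← hsymp]
    rw [transpose_mul]; simp only [Matrix.mul_assoc]
  rw [hMW, hW, hJ] at hWJ
  simp only [fromBlocks_transpose, fromBlocks_multiply, fromBlocks_inj] at hWJ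
  obtain ⟨-, -, e3, e4⟩ := hWJ
  simp at e3 e4
  have hMtQ : Mt = Qᵀ * p := by
    rw [hMt]
    have := congrArg Neg.neg e3
    simp at this
    rw [← this]; abel
  have e4' : YBᵀ * YA = YAᵀ * YB := by
    rw [← sub_eq_zero, ← neg_eq_zero]; rw [← e4]; abel
  have uMt : IsUnit Mt := by
    rw [hMtQ]; exact ((isUnit_transpose Q).2 hQ).mul hp
  refine ⟨uMt, ?_⟩
  have dMt : IsUnit Mt.det := (isUnit_iff_isUnit_det _).1 uMt
  have uMW : IsUnit (M * W) := by
    rw [hMW]; exact isUnit_fromBlocks_zero₁₂.2 ⟨hp, hQ⟩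
  have dMW := (isUnit_iff_isUnit_det _).1 uMW
  rw [det_mul, IsUnit.mul_iff] at dMW
  obtain ⟨dM, dW⟩ := dMW
  set S := fromBlocks ((2 : ℝ) • (XA * Mt⁻¹ * YBᵀ) - 1) (-((2 : ℝ) • (XA * Mt⁻¹ * YAᵀ)))
        ((2 : ℝ) • (XB * Mt⁻¹ * YBᵀ)) (-((2 : ℝ) • (XB * Mt⁻¹ * YAᵀ) + 1)) with hS
  have key : ∀ Z : Matrix (Fin g) (Fin g) ℝ,
      Z * Mt⁻¹ * YBᵀ * XA - Z * Mt⁻¹ * YAᵀ * XB = Z := by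
    intro Z
    have : Z * Mt⁻¹ * (YBᵀ * XA - YAᵀ * XB) = Z := by
      rw [← hMt, Matrix.mul_assoc, nonsing_inv_mul _ dMt, Matrix.mul_one]
    rw [Matrix.mul_sub, ← Matrix.mul_assoc, ← Matrix.mul_assoc] at this
    exact this
  have key2 : ∀ Z : Matrix (Fin g) (Fin g) ℝ,
      Z * Mt⁻¹ * YBᵀ * YA = Z * Mt⁻¹ * YAᵀ * YB := by
    intro Z
    rw [Matrix.mul_assoc _ YBᵀ, e4', Matrix.mul_assoc _ YAᵀ]
  have hSW : S * W = fromBlocks XA (-YA) XB (-YB) := by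
    rw [hS, hW, fromBlocks_multiply, fromBlocks_inj]
    have kA := key XA
    have kB := key XB
    have kA2 := key2 XA
    have kB2 := key2 XB
    simp only [Matrix.sub_mul, Matrix.add_mul, Matrix.neg_mul, Matrix.smul_mul, Matrix.one_mul]
    refine ⟨?_, ?_, ?_, ?_⟩
    · linear_combination (norm := module) (2 : ℝ) • kA
    · linear_combination (norm := module) (2 : ℝ) • kA2
    · linear_combination (norm := module) (2 : ℝ) • kB
    · linear_combination (norm := module) (2 : ℝ) • kB2
  have hKMW : K * (M * W) = M * (S * W) := by
    have hd : fromBlocks XA (-YA) XB (-YB) = W * fromBlocks 1 0 0 (-1) := by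
      simp [hW, fromBlocks_multiply]
    rw [hSW, hd, ← Matrix.mul_assoc M W, hMW, hK]
    simp only [fromBlocks_multiply, fromBlocks_inj]
    refine ⟨by simp, by simp, ?_, by simp⟩
    simp
    module
  have hKM : K * M = M * S := by
    have := congrArg (· * W⁻¹) hKMW
    simp only [← Matrix.mul_assoc] at this
    simpa [mul_nonsing_inv_cancel_right _ _ dW] using this
  have hR : M⁻¹ * K * M = S := by
    rw [Matrix.mul_assoc, hKM, nonsing_inv_mul_cancel_left _ _ dM]
  have hKJ : Kᵀ * J = -(J * K) := by
    rw [hK, hJ]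
    simp [fromBlocks_transpose, fromBlocks_multiply, fromBlocks_neg, hH]
  have hSJ : Sᵀ * J = -(J * S) := by
    have a1 : J * S = Mᵀ * J * K * M := by
      nth_rewrite 1 [← hsymp]
      rw [Matrix.mul_assoc _ M S, ← hKM]; simp only [Matrix.mul_assoc]
    have a2 : Sᵀ * J = Mᵀ * Kᵀ * J * M := by
      nth_rewrite 1 [← hsymp]
      rw [← Matrix.mul_assoc, ← Matrix.mul_assoc, ← transpose_mul, ← hKM, transpose_mul]
    rw [a1, a2, Matrix.mul_assoc Mᵀ, hKJ]; simp [Matrix.mul_assoc]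
  rw [hS, hJ] at hSJ
  simp only [fromBlocks_transpose, fromBlocks_multiply, fromBlocks_neg, fromBlocks_inj] at hSJ
  obtain ⟨-, f2, -, -⟩ := hSJ
  simp only [Matrix.mul_zero, Matrix.mul_one, Matrix.zero_mul, Matrix.one_mul, zero_add,
    add_zero, neg_neg] at f2
  rw [hR, hS, ← f2, transpose_transpose]

/-- Let H be a symmetric g×g integer matrix, M = [[A,B],[C,D]] ∈
Sp(2g,ℤ), and P̃_A, P̃_B complex g×g matrices with P_A := A·P̃_A + B·P̃_B real
and invertible, Re(P_B) = (1/2)·H·P_A, and Im(P_B) invertible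
(P_B := C·P̃_A + D·P̃_B). Then M̃ := Im(P̃_Bᵀ)·Re(P̃_A) − Im(P̃_Aᵀ)·Re(P̃_B) is
invertible and R := M⁻¹·K_H·M is given by the explicit block formula
[[(2·Re(P̃_B)·M̃⁻¹·Im(P̃_Aᵀ) + I)ᵀ, −2·Re(P̃_A)·M̃⁻¹·Im(P̃_Aᵀ)],
 [2·Re(P̃_B)·M̃⁻¹·Im(P̃_Bᵀ), −(2·Re(P̃_B)·M̃⁻¹·Im(P̃_Aᵀ) + I)]]. -/
theorem stmt_1 (g : ℕ) (hg : 1 ≤ g)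
    (H A B C D : Matrix (Fin g) (Fin g) ℤ) (hH : Hᵀ = H)
    (hsymp : (Matrix.fromBlocks A B C D)ᵀ * Matrix.fromBlocks 0 1 (-1) 0 *
        Matrix.fromBlocks A B C D = (Matrix.fromBlocks 0 1 (-1) 0 :
        Matrix (Fin g ⊕ Fin g) (Fin g ⊕ Fin g) ℤ))
    (PtA PtB PA PB : Matrix (Fin g) (Fin g) ℂ)
    (hPA : PA = A.map (Int.cast : ℤ → ℂ) * PtA + B.map (Int.cast : ℤ → ℂ) * PtB)
    (hPB : PB = C.map (Int.cast : ℤ → ℂ) * PtA + D.map (Int.cast : ℤ → ℂ) * PtB)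
    (hPAreal : ∀ i j, (PA i j).im = 0)
    (hPAinv : IsUnit PA)
    (hRePB : PB.map Complex.re =
      (1 / 2 : ℝ) • (H.map (Int.cast : ℤ → ℝ) * PA.map Complex.re))
    (hImPB : IsUnit (PB.map Complex.im))
    (Mt : Matrix (Fin g) (Fin g) ℝ)
    (hMt : Mt = (PtBᵀ).map Complex.im * PtA.map Complex.re -
      (PtAᵀ).map Complex.im * PtB.map Complex.re) :
    IsUnit Mt ∧
    (Matrix.fromBlocks (A.map (Int.cast : ℤ → ℝ)) (B.map (Int.cast : ℤ → ℝ))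
          (C.map (Int.cast : ℤ → ℝ)) (D.map (Int.cast : ℤ → ℝ)))⁻¹ *
        Matrix.fromBlocks 1 0 (H.map (Int.cast : ℤ → ℝ)) (-1) *
        Matrix.fromBlocks (A.map (Int.cast : ℤ → ℝ)) (B.map (Int.cast : ℤ → ℝ))
          (C.map (Int.cast : ℤ → ℝ)) (D.map (Int.cast : ℤ → ℝ)) =
      Matrix.fromBlocks
        (((2 : ℝ) • (PtB.map Complex.re * Mt⁻¹ * (PtAᵀ).map Complex.im) + 1)ᵀ)
        (-((2 : ℝ) • (PtA.map Complex.re * Mt⁻¹ * (PtAᵀ).map Complex.im)))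
        ((2 : ℝ) • (PtB.map Complex.re * Mt⁻¹ * (PtBᵀ).map Complex.im))
        (-((2 : ℝ) • (PtB.map Complex.re * Mt⁻¹ * (PtAᵀ).map Complex.im) + 1)) := by
  have hre : ∀ (X Y : Matrix (Fin g) (Fin g) ℤ) (Z V : Matrix (Fin g) (Fin g) ℂ),
      (X.map (Int.cast : ℤ → ℂ) * Z + Y.map (Int.cast : ℤ → ℂ) * V).map Complex.re =
      X.map (Int.cast : ℤ → ℝ) * Z.map Complex.re +
        Y.map (Int.cast : ℤ → ℝ) * V.map Complex.re := by
    intro X Y Z V; ext i j; simp [Matrix.mul_apply]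
  have him : ∀ (X Y : Matrix (Fin g) (Fin g) ℤ) (Z V : Matrix (Fin g) (Fin g) ℂ),
      (X.map (Int.cast : ℤ → ℂ) * Z + Y.map (Int.cast : ℤ → ℂ) * V).map Complex.im =
      X.map (Int.cast : ℤ → ℝ) * Z.map Complex.im +
        Y.map (Int.cast : ℤ → ℝ) * V.map Complex.im := by
    intro X Y Z V; ext i j; simp [Matrix.mul_apply]
  have hPAc : PA = (PA.map Complex.re).map (Complex.ofRealHom) := by
    ext i j
    apply Complex.ext <;> simp [hPAreal]
  have hp : IsUnit (PA.map Complex.re) := by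
    rw [isUnit_iff_isUnit_det] at hPAinv ⊢
    rw [hPAc, ← RingHom.mapMatrix_apply, ← RingHom.map_det] at hPAinv
    rw [isUnit_iff_ne_zero] at hPAinv ⊢
    intro h; rw [h] at hPAinv; simp at hPAinv
  have hs := congrArg (fun X => X.map (Int.castRingHom ℝ)) hsymp
  have hneg : (-1 : Matrix (Fin g) (Fin g) ℤ).map (Int.castRingHom ℝ) = -1 := by
    ext i j; simp [Matrix.one_apply]
  simp only [Matrix.map_mul, transpose_map, fromBlocks_map, hneg, Matrix.map_zero _ (map_zero _),
    Matrix.map_one _ (map_zero _) (map_one _)] at hs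
  refine aux_core_s1 (H.map (Int.cast : ℤ → ℝ)) _ _ _ _ _ _ (PtA.map Complex.im)
    (PtB.map Complex.im) (PA.map Complex.re) (PB.map Complex.im) Mt ?_ ?_ ?_ ?_ ?_ ?_ hp hImPB hMt
  · rw [← transpose_map, hH]
  · rw [fromBlocks_transpose] at hs ⊢
    simpa [fromBlocks_map, transpose_map] using hs
  · rw [hPA, hre]
  · rw [← him, ← hPA]; ext i j; simp [hPAreal]
  · rw [← hRePB, hPB, hre]
  · rw [hPB, him]
end

section
/- Let g ≥ 1, let H be a g×g integer matrix, let R be a 2g×2g integer matrix, and let M = [[A,B],[C,D]] be a 2g×2g integer matrix with determinant ±1 (i.e., M ∈ GL_{2g}(ℤ)) such that M·R = K_H·M. Then the g columns u₁, …, u_g of the 2g×g matrix [Aᵀ; Bᵀ] (equivalently, the transposes of the first g rows of M) form a ℤ-basis of the ℤ-module K_ℤ := {w ∈ ℤ^{2g} : Rᵀ·w = w}: they are ℤ-linearly independent and their ℤ-span equals K_ℤ. -/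
open Matrix

/-- If M = [[A,B],[C,D]] ∈ GL_{2g}(ℤ) satisfies M·R = K_H·M, then
the transposes of the first g rows of M (the columns of [Aᵀ;Bᵀ]) form a
ℤ-basis of K_ℤ = {w ∈ ℤ^{2g} : Rᵀ·w = w}: they are ℤ-linearly independent and
their ℤ-span equals K_ℤ. -/
theorem stmt_4 (g : ℕ) (hg : 1 ≤ g)
    (H : Matrix (Fin g) (Fin g) ℤ)
    (R M : Matrix (Fin g ⊕ Fin g) (Fin g ⊕ Fin g) ℤ)
    (hM : IsUnit M.det)
    (hMR : M * R = Matrix.fromBlocks 1 0 H (-1) * M) :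
    LinearIndependent ℤ (fun i : Fin g => fun j : Fin g ⊕ Fin g => M (Sum.inl i) j) ∧
    Submodule.span ℤ (Set.range fun i : Fin g => fun j : Fin g ⊕ Fin g => M (Sum.inl i) j) =
      LinearMap.ker (Matrix.mulVecLin (Rᵀ - 1)) := by
  have hMu : IsUnit M := (Matrix.isUnit_iff_isUnit_det M).2 hM
  have hinj : Function.Injective (fun v : Fin g ⊕ Fin g → ℤ => v ᵥ* M) :=
    Matrix.vecMul_injective_of_isUnit hMu
  have hli : LinearIndependent ℤ M.row := Matrix.vecMul_injective_iff.1 hinj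
  refine ⟨hli.comp Sum.inl Sum.inl_injective, ?_⟩
  have hker : ∀ w : Fin g ⊕ Fin g → ℤ,
      w ∈ LinearMap.ker (Matrix.mulVecLin (Rᵀ - 1)) ↔ w ᵥ* R = w := by
    intro w
    rw [LinearMap.mem_ker, Matrix.mulVecLin_apply, Matrix.sub_mulVec, Matrix.one_mulVec,
      Matrix.mulVec_transpose, sub_eq_zero]
  have hcomb : ∀ c : Fin g → ℤ,
      ∑ i, c i • (fun j : Fin g ⊕ Fin g => M (Sum.inl i) j) = Sum.elim c 0 ᵥ* M := by
    intro c
    ext j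
    simp [Matrix.vecMul, dotProduct, Finset.sum_apply]
  have hK : ∀ v : Fin g ⊕ Fin g → ℤ, (v ᵥ* M) ᵥ* R = v ᵥ* M ↔
      v ᵥ* Matrix.fromBlocks 1 0 H (-1) = v := by
    intro v
    rw [Matrix.vecMul_vecMul, hMR, ← Matrix.vecMul_vecMul]
    exact hinj.eq_iff
  ext w
  rw [hker, Submodule.mem_span_range_iff_exists_fun]
  constructor
  · rintro ⟨c, rfl⟩
    rw [hcomb, hK, Matrix.vecMul_fromBlocks]
    ext (i | i) <;> simp
  · intro hw
    have hwM : (w ᵥ* M⁻¹) ᵥ* M = w := by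
      rw [Matrix.vecMul_vecMul, Matrix.nonsing_inv_mul _ hM, Matrix.vecMul_one]
    generalize w ᵥ* M⁻¹ = v at hwM
    subst hwM
    rw [hK, Matrix.vecMul_fromBlocks] at hw
    refine ⟨v ∘ Sum.inl, ?_⟩
    rw [hcomb]
    congr 1
    ext (i | i)
    · simp
    · have h := congrFun hw (Sum.inr i)
      simp [Matrix.vecMul_neg] at h
      simp
      omega
end

section
/- Let g ≥ 1, let H be a symmetric g×g integer matrix, and let Q₀ ∈ GL_g(ℤ) satisfy Q₀·H·Q₀ᵀ ≡ H (mod 2). Then the 2g×2g block matrix M := [[Q₀ᵀ, 0], [(1/2)(H·Q₀ᵀ − Q₀⁻¹·H), Q₀⁻¹]] has integer entries, is symplectic (Mᵀ·J·M = J), and satisfies M·K_H = K_H·M. Conversely, the lower-left block (1/2)(H·Q₀ᵀ − Q₀⁻¹·H) has integer entries if and only if Q₀·H·Q₀ᵀ ≡ H (mod 2). -/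
open Matrix

/-- Left multiplication by an integer matrix preserves evenness of entries. -/
lemma even_mul_left {g : ℕ} (P N : Matrix (Fin g) (Fin g) ℤ)
    (h : ∀ i j, (2 : ℤ) ∣ N i j) : ∀ i j, (2 : ℤ) ∣ (P * N) i j := by
  intro i j
  rw [Matrix.mul_apply]
  exact Finset.dvd_sum fun k _ => Dvd.dvd.mul_left (h k j) _

/-- For symmetric H and Q₀ ∈ GL_g(ℤ), the lower-left block
L = (1/2)(H·Q₀ᵀ − Q₀⁻¹·H) has integer entries iff Q₀·H·Q₀ᵀ ≡ H (mod 2), and in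
that case the block matrix M = [[Q₀ᵀ, 0], [L, Q₀⁻¹]] has integer entries, is
symplectic, and commutes with K_H. -/
theorem stmt_9 (g : ℕ) (hg : 1 ≤ g)
    (H Q₀ : Matrix (Fin g) (Fin g) ℤ) (hH : Hᵀ = H) (hQ₀ : IsUnit Q₀.det) :
    let L : Matrix (Fin g) (Fin g) ℚ :=
      (1 / 2 : ℚ) • (H.map (Int.cast : ℤ → ℚ) * (Q₀ᵀ).map (Int.cast : ℤ → ℚ)
        - (Q₀⁻¹).map (Int.cast : ℤ → ℚ) * H.map (Int.cast : ℤ → ℚ))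
    let M : Matrix (Fin g ⊕ Fin g) (Fin g ⊕ Fin g) ℚ :=
      Matrix.fromBlocks ((Q₀ᵀ).map (Int.cast : ℤ → ℚ)) 0 L ((Q₀⁻¹).map (Int.cast : ℤ → ℚ))
    ((∀ i j, ∃ z : ℤ, L i j = (z : ℚ)) ↔
      (∀ i j, (2 : ℤ) ∣ ((Q₀ * H * Q₀ᵀ) i j - H i j))) ∧
    ((∀ i j, (2 : ℤ) ∣ ((Q₀ * H * Q₀ᵀ) i j - H i j)) →
      ((∀ i j, ∃ z : ℤ, M i j = (z : ℚ)) ∧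
        Mᵀ * Matrix.fromBlocks 0 1 (-1) 0 * M = Matrix.fromBlocks 0 1 (-1) 0 ∧
        M * Matrix.fromBlocks 1 0 (H.map (Int.cast : ℤ → ℚ)) (-1) =
          Matrix.fromBlocks 1 0 (H.map (Int.cast : ℤ → ℚ)) (-1) * M)) := by
  intro L M
  have hQD : Q₀ * Q₀⁻¹ = 1 := Matrix.mul_nonsing_inv _ hQ₀
  have hDQ : Q₀⁻¹ * Q₀ = 1 := Matrix.nonsing_inv_mul _ hQ₀
  have hL : ∀ i j, L i j = (((H * Q₀ᵀ - Q₀⁻¹ * H) i j : ℤ) : ℚ) / 2 := by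
    intro i j
    simp only [L, Matrix.smul_apply, Matrix.sub_apply, Matrix.mul_apply, Matrix.map_apply,
      smul_eq_mul]
    push_cast
    ring
  have hL2 : (∀ i j, ∃ z : ℤ, L i j = (z : ℚ)) ↔
      ∀ i j, (2 : ℤ) ∣ (H * Q₀ᵀ - Q₀⁻¹ * H) i j := by
    refine forall_congr' fun i => forall_congr' fun j => ?_
    rw [hL]
    refine exists_congr fun z => ?_
    rw [div_eq_iff (by norm_num)]
    constructor
    · intro h
      have : (H * Q₀ᵀ - Q₀⁻¹ * H) i j = z * 2 := by exact_mod_cast h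
      rw [this, mul_comm]
    · intro h
      rw [h]
      push_cast
      ring
  have e1 : Q₀ * (H * Q₀ᵀ - Q₀⁻¹ * H) = Q₀ * H * Q₀ᵀ - H := by
    rw [Matrix.mul_sub, ← Matrix.mul_assoc, ← Matrix.mul_assoc, hQD, Matrix.one_mul]
  have e2 : Q₀⁻¹ * (Q₀ * H * Q₀ᵀ - H) = H * Q₀ᵀ - Q₀⁻¹ * H := by
    rw [← e1, ← Matrix.mul_assoc, hDQ, Matrix.one_mul]
  have hiff : (∀ i j, ∃ z : ℤ, L i j = (z : ℚ)) ↔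
      (∀ i j, (2 : ℤ) ∣ ((Q₀ * H * Q₀ᵀ) i j - H i j)) := by
    rw [hL2]
    constructor
    · intro h
      have := even_mul_left Q₀ _ h
      rw [e1] at this
      exact this
    · intro h
      have := even_mul_left Q₀⁻¹ (Q₀ * H * Q₀ᵀ - H) h
      rw [e2] at this
      exact this
  refine ⟨hiff, fun h => ⟨?_, ?_, ?_⟩⟩
  · have hi := hiff.2 h
    rintro (i | i) (j | j)
    · exact ⟨Q₀ᵀ i j, rfl⟩
    · exact ⟨0, by simp [M]⟩
    · exact hi i j
    · exact ⟨Q₀⁻¹ i j, rfl⟩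
  · have hqd : Q₀.map (Int.cast : ℤ → ℚ) * (Q₀⁻¹).map (Int.cast : ℤ → ℚ) = 1 := by
      have := congrArg (fun X => X.map (Int.castRingHom ℚ)) hQD
      simp only [Matrix.map_mul, Matrix.map_one _ (map_zero (Int.castRingHom ℚ))
        (map_one (Int.castRingHom ℚ))] at this
      exact this
    have hh : (H.map (Int.cast : ℤ → ℚ))ᵀ = H.map (Int.cast : ℤ → ℚ) := by
      rw [← Matrix.transpose_map, hH]
    simp only [M, L, Matrix.transpose_map]
    generalize H.map (Int.cast : ℤ → ℚ) = b at *
    generalize Q₀.map (Int.cast : ℤ → ℚ) = q at *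
    generalize (Q₀⁻¹).map (Int.cast : ℤ → ℚ) = d at *
    have hqd' : dᵀ * qᵀ = 1 := by rw [← Matrix.transpose_mul, hqd, Matrix.transpose_one]
    rw [Matrix.fromBlocks_transpose, Matrix.fromBlocks_multiply, Matrix.fromBlocks_multiply]
    congr 1
    · simp only [Matrix.transpose_smul, Matrix.transpose_sub, Matrix.transpose_mul,
        Matrix.transpose_transpose, hh, Matrix.mul_zero, Matrix.mul_one, Matrix.mul_neg, zero_add,
        add_zero, Matrix.neg_mul, Matrix.smul_mul, Matrix.mul_smul, Matrix.sub_mul,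
        Matrix.mul_sub]
      rw [← Matrix.mul_assoc q d b, hqd, Matrix.mul_assoc b, hqd', ← Matrix.mul_assoc q b]
      simp
    · simp [hqd]
    · simp [hqd']
    · simp
  · simp only [M, L]
    rw [Matrix.fromBlocks_multiply, Matrix.fromBlocks_multiply]
    congr 1
    · simp
    · simp
    · simp only [Matrix.mul_one, Matrix.neg_mul, Matrix.one_mul]
      module
    · simp
end

section
/- Let g ≥ 1, let H be a g×g integer matrix, let M = [[A,B],[C,D]] ∈ Sp(2g,ℤ), and let P̃_A, P̃_B be complex g×g matrices. Set P_A := A·P̃_A + B·P̃_B and P_B := C·P̃_A + D·P̃_B, and assume that P_A has real entries and is invertible, that Re(P_B) = (1/2)·H·P_A, and that Im(P_B) = C·Im(P̃_A) + D·Im(P̃_B) is invertible. Then the following four identities hold: Aᵀ = Im(P̃_B)·[C·Im(P̃_A) + D·Im(P̃_B)]⁻¹; Bᵀ = −Im(P̃_A)·[C·Im(P̃_A) + D·Im(P̃_B)]⁻¹; Cᵀ = (1/2)·Aᵀ·H − Re(P̃_B)·[A·Re(P̃_A) + B·Re(P̃_B)]⁻¹; Dᵀ = (1/2)·Bᵀ·H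 + Re(P̃_A)·[A·Re(P̃_A) + B·Re(P̃_B)]⁻¹. -/
open Matrix

lemma aux_re_s10 {g : ℕ} (A B : Matrix (Fin g) (Fin g) ℤ) (X Y : Matrix (Fin g) (Fin g) ℂ) :
    (A.map (Int.cast : ℤ → ℂ) * X + B.map (Int.cast : ℤ → ℂ) * Y).map Complex.re =
      A.map (Int.cast : ℤ → ℝ) * X.map Complex.re + B.map (Int.cast : ℤ → ℝ) * Y.map Complex.re := by
  ext i j
  simp [Matrix.mul_apply]

lemma aux_im_s10 {g : ℕ} (A B : Matrix (Fin g) (Fin g) ℤ) (X Y : Matrix (Fin g) (Fin g) ℂ) :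
    (A.map (Int.cast : ℤ → ℂ) * X + B.map (Int.cast : ℤ → ℂ) * Y).map Complex.im =
      A.map (Int.cast : ℤ → ℝ) * X.map Complex.im + B.map (Int.cast : ℤ → ℝ) * Y.map Complex.im := by
  ext i j
  simp [Matrix.mul_apply]

lemma aux_cast {g : ℕ} {A B C D E : Matrix (Fin g) (Fin g) ℤ} (h : Aᵀ * B - Cᵀ * D = E) :
    (A.map (Int.cast : ℤ → ℝ))ᵀ * B.map (Int.cast : ℤ → ℝ) =
      (C.map (Int.cast : ℤ → ℝ))ᵀ * D.map (Int.cast : ℤ → ℝ) + E.map (Int.cast : ℤ → ℝ) := by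
  subst h
  ext i j
  simp [Matrix.mul_apply]

lemma aux_unit {g : ℕ} (P : Matrix (Fin g) (Fin g) ℂ) (h : ∀ i j, (P i j).im = 0)
    (hP : IsUnit P) : IsUnit (P.map Complex.re) := by
  have e : P = Complex.ofRealHom.mapMatrix (P.map Complex.re) := by
    ext i j
    apply Complex.ext <;> simp [h]
  rw [Matrix.isUnit_iff_isUnit_det, isUnit_iff_ne_zero] at hP ⊢
  intro h0
  apply hP
  rw [e, ← RingHom.map_det, h0, map_zero]

lemma aux_inv {g : ℕ} {X Y Q : Matrix (Fin g) (Fin g) ℝ} (hQ : IsUnit Q) (h : X * Q = Y) :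
    X = Y * Q⁻¹ := by
  rw [← h, Matrix.mul_assoc, Matrix.mul_nonsing_inv _ ((Matrix.isUnit_iff_isUnit_det _).1 hQ),
    Matrix.mul_one]

/-- Let M = [[A,B],[C,D]] ∈ Sp(2g,ℤ) and P̃_A, P̃_B complex g×g
matrices, P_A := A·P̃_A + B·P̃_B, P_B := C·P̃_A + D·P̃_B. If P_A is real and
invertible, Re(P_B) = (1/2)·H·P_A, and Im(P_B) is invertible, then
Aᵀ = Im(P̃_B)·[C·Im(P̃_A)+D·Im(P̃_B)]⁻¹, Bᵀ = −Im(P̃_A)·[C·Im(P̃_A)+D·Im(P̃_B)]⁻¹,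
Cᵀ = (1/2)·Aᵀ·H − Re(P̃_B)·[A·Re(P̃_A)+B·Re(P̃_B)]⁻¹ and
Dᵀ = (1/2)·Bᵀ·H + Re(P̃_A)·[A·Re(P̃_A)+B·Re(P̃_B)]⁻¹. -/
theorem stmt_10 (g : ℕ) (hg : 1 ≤ g)
    (H A B C D : Matrix (Fin g) (Fin g) ℤ)
    (hsymp : (Matrix.fromBlocks A B C D)ᵀ * Matrix.fromBlocks 0 1 (-1) 0 *
        Matrix.fromBlocks A B C D = (Matrix.fromBlocks 0 1 (-1) 0 :
        Matrix (Fin g ⊕ Fin g) (Fin g ⊕ Fin g) ℤ))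
    (PtA PtB PA PB : Matrix (Fin g) (Fin g) ℂ)
    (hPA : PA = A.map (Int.cast : ℤ → ℂ) * PtA + B.map (Int.cast : ℤ → ℂ) * PtB)
    (hPB : PB = C.map (Int.cast : ℤ → ℂ) * PtA + D.map (Int.cast : ℤ → ℂ) * PtB)
    (hPAreal : ∀ i j, (PA i j).im = 0)
    (hPAinv : IsUnit PA)
    (hRePB : PB.map Complex.re =
      (1 / 2 : ℝ) • (H.map (Int.cast : ℤ → ℝ) * PA.map Complex.re))
    (hImPB : IsUnit (PB.map Complex.im)) :
    (A.map (Int.cast : ℤ → ℝ))ᵀ =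
      PtB.map Complex.im *
        (C.map (Int.cast : ℤ → ℝ) * PtA.map Complex.im +
          D.map (Int.cast : ℤ → ℝ) * PtB.map Complex.im)⁻¹ ∧
    (B.map (Int.cast : ℤ → ℝ))ᵀ =
      -(PtA.map Complex.im) *
        (C.map (Int.cast : ℤ → ℝ) * PtA.map Complex.im +
          D.map (Int.cast : ℤ → ℝ) * PtB.map Complex.im)⁻¹ ∧
    (C.map (Int.cast : ℤ → ℝ))ᵀ =
      (1 / 2 : ℝ) • ((A.map (Int.cast : ℤ → ℝ))ᵀ * H.map (Int.cast : ℤ → ℝ)) -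
        PtB.map Complex.re *
          (A.map (Int.cast : ℤ → ℝ) * PtA.map Complex.re +
            B.map (Int.cast : ℤ → ℝ) * PtB.map Complex.re)⁻¹ ∧
    (D.map (Int.cast : ℤ → ℝ))ᵀ =
      (1 / 2 : ℝ) • ((B.map (Int.cast : ℤ → ℝ))ᵀ * H.map (Int.cast : ℤ → ℝ)) +
        PtA.map Complex.re *
          (A.map (Int.cast : ℤ → ℝ) * PtA.map Complex.re +
            B.map (Int.cast : ℤ → ℝ) * PtB.map Complex.re)⁻¹ := by
  have h4 := hsymp
  simp only [Matrix.fromBlocks_transpose, Matrix.fromBlocks_multiply, Matrix.fromBlocks_inj] at h4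
  obtain ⟨h1, h2, h3, h4⟩ := h4
  have e1 := aux_cast (A := A) (B := C) (C := C) (D := A) (E := 0) (by rw [← h1]; simp; abel)
  have e2 := aux_cast (A := A) (B := D) (C := C) (D := B) (E := 1) (by rw [← h2]; simp; abel)
  have e3 := aux_cast (A := B) (B := C) (C := D) (D := A) (E := -1) (by rw [← h3]; simp; abel)
  have e4 := aux_cast (A := B) (B := D) (C := D) (D := B) (E := 0) (by rw [← h4]; simp; abel)
  have hm1 : (-1 : Matrix (Fin g) (Fin g) ℤ).map (Int.cast : ℤ → ℝ) = -1 := by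
    ext i j
    simp [Matrix.one_apply]
  have hp1 : (1 : Matrix (Fin g) (Fin g) ℤ).map (Int.cast : ℤ → ℝ) = 1 := by
    ext i j
    simp [Matrix.one_apply]
  have hp0 : (0 : Matrix (Fin g) (Fin g) ℤ).map (Int.cast : ℤ → ℝ) = 0 := by
    ext i j
    simp
  rw [hp0] at e1 e4
  rw [hp1] at e2
  rw [hm1] at e3
  have hR := aux_unit PA hPAreal hPAinv
  have hI : PA.map Complex.im = 0 := by
    ext i j
    simp [hPAreal]
  have hRe := aux_re_s10 A B PtA PtB
  rw [← hPA] at hRe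
  have hIm := aux_im_s10 A B PtA PtB
  rw [← hPA, hI] at hIm
  have hRe' := aux_re_s10 C D PtA PtB
  rw [← hPB, hRePB] at hRe'
  have hIm' := aux_im_s10 C D PtA PtB
  rw [← hPB] at hIm'
  rw [← hIm', ← hRe]
  generalize PB.map Complex.im = Q at *
  generalize PA.map Complex.re = R at *
  generalize A.map (Int.cast : ℤ → ℝ) = a at *
  generalize B.map (Int.cast : ℤ → ℝ) = b at *
  generalize C.map (Int.cast : ℤ → ℝ) = c at *
  generalize D.map (Int.cast : ℤ → ℝ) = d at *
  generalize H.map (Int.cast : ℤ → ℝ) = h at *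
  generalize PtA.map Complex.im = X at *
  generalize PtB.map Complex.im = Y at *
  generalize PtA.map Complex.re = U at *
  generalize PtB.map Complex.re = V at *
  refine ⟨aux_inv hImPB ?_, aux_inv hImPB ?_, ?_, ?_⟩
  · calc aᵀ * Q = (aᵀ * c) * X + (aᵀ * d) * Y := by rw [hIm']; noncomm_ring
      _ = cᵀ * (a * X + b * Y) + Y := by rw [e1, e2]; noncomm_ring
      _ = Y := by rw [← hIm]; simp
  · calc bᵀ * Q = (bᵀ * c) * X + (bᵀ * d) * Y := by rw [hIm']; noncomm_ring
      _ = dᵀ * (a * X + b * Y) - X := by rw [e3, e4]; noncomm_ring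
      _ = -X := by rw [← hIm]; simp
  · rw [← aux_inv hR (X := (1 / 2 : ℝ) • (aᵀ * h) - cᵀ) (Y := V), sub_sub_cancel]
    calc ((1 / 2 : ℝ) • (aᵀ * h) - cᵀ) * R = aᵀ * ((1 / 2 : ℝ) • (h * R)) - cᵀ * R := by
          rw [sub_mul, smul_mul_assoc, mul_smul_comm, mul_assoc]
      _ = (aᵀ * c) * U + (aᵀ * d) * V - cᵀ * (a * U + b * V) := by
          rw [hRe', ← hRe]; noncomm_ring
      _ = V := by rw [e1, e2]; noncomm_ring
  · rw [← aux_inv hR (X := dᵀ - (1 / 2 : ℝ) • (bᵀ * h)) (Y := U), add_sub_cancel]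
    calc (dᵀ - (1 / 2 : ℝ) • (bᵀ * h)) * R = dᵀ * R - bᵀ * ((1 / 2 : ℝ) • (h * R)) := by
          rw [sub_mul, smul_mul_assoc, mul_smul_comm, mul_assoc]
      _ = dᵀ * (a * U + b * V) - ((bᵀ * c) * U + (bᵀ * d) * V) := by
          rw [hRe', ← hRe]; noncomm_ring
      _ = U := by rw [e3, e4]; noncomm_ring
end

section
/- Let g ≥ 1, let H be a g×g integer matrix, let M = [[A,B],[C,D]] ∈ Sp(2g,ℤ), and let P̃_A, P̃_B be complex g×g matrices. Set P_A := A·P̃_A + B·P̃_B and P_B := C·P̃_A + D·P̃_B, and assume that P_A has real entries and is invertible, that Re(P_B) = (1/2)·H·P_A, and that Im(P_B) is invertible. Then M̃ := Im(P̃_Bᵀ)·Re(P̃_A) − Im(P̃_Aᵀ)·Re(P̃_B) is invertible and the following three identities hold: 2·Cᵀ·A = Aᵀ·H·A − 2·Re(P̃_B)·M̃⁻¹·Im(P̃_Bᵀ); 2·Cᵀ·B = Aᵀ·H·B + 2·Re(P̃_B)·M̃⁻¹·Im(P̃_Aᵀ); 2·Dᵀ·B = Bᵀ·H·B − 2·Re(P̃_A)·M̃⁻¹·Im(P̃_Aᵀ).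 -/
open Matrix

theorem aux_real {g : ℕ} (H A B C D a b x y R Y Mt : Matrix (Fin g) (Fin g) ℝ)
    (h1 : Aᵀ * C = Cᵀ * A) (h2 : Bᵀ * D = Dᵀ * B) (h3 : Aᵀ * D - Cᵀ * B = 1)
    (hR : R = A * a + B * b) (h0 : A * x + B * y = 0)
    (hH : C * a + D * b = (1 / 2 : ℝ) • (H * R)) (hY : Y = C * x + D * y)
    (uR : IsUnit R) (uY : IsUnit Y) (hMt : Mt = yᵀ * a - xᵀ * b) :
    IsUnit Mt ∧ (2 : ℝ) • (Cᵀ * A) = Aᵀ * H * A - (2 : ℝ) • (b * Mt⁻¹ * yᵀ) ∧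
    (2 : ℝ) • (Cᵀ * B) = Aᵀ * H * B + (2 : ℝ) • (b * Mt⁻¹ * xᵀ) ∧
    (2 : ℝ) • (Dᵀ * B) = Bᵀ * H * B - (2 : ℝ) • (a * Mt⁻¹ * xᵀ) := by
  have h4 : Dᵀ * A - Bᵀ * C = 1 := by
    have := congrArg Matrix.transpose h3
    simpa using this
  have ea : a = (Dᵀ - (1 / 2 : ℝ) • (Bᵀ * H)) * R := by
    have e : a = (Dᵀ * A - Bᵀ * C) * a + (Dᵀ * B - Bᵀ * D) * b := by
      rw [h4, h2]; simp
    have e2 : a = Dᵀ * (A * a + B * b) - Bᵀ * (C * a + D * b) := by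
      refine e.trans ?_
      noncomm_ring
    rw [hH, ← hR] at e2
    rw [sub_mul, Matrix.smul_mul, Matrix.mul_assoc, ← Matrix.mul_smul]
    exact e2
  have eb : b = ((1 / 2 : ℝ) • (Aᵀ * H) - Cᵀ) * R := by
    have e : b = (Aᵀ * C - Cᵀ * A) * a + (Aᵀ * D - Cᵀ * B) * b := by
      rw [h3, h1]; simp
    have e2 : b = Aᵀ * (C * a + D * b) - Cᵀ * (A * a + B * b) := by
      refine e.trans ?_
      noncomm_ring
    rw [hH, ← hR] at e2
    rw [sub_mul, Matrix.smul_mul, Matrix.mul_assoc, ← Matrix.mul_smul]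
    exact e2
  have ex : x = -(Bᵀ * Y) := by
    have e : x = (Dᵀ * A - Bᵀ * C) * x + (Dᵀ * B - Bᵀ * D) * y := by
      rw [h4, h2]; simp
    have e2 : x = Dᵀ * (A * x + B * y) - Bᵀ * (C * x + D * y) := by
      refine e.trans ?_
      noncomm_ring
    rw [h0, ← hY] at e2
    simpa using e2
  have ey : y = Aᵀ * Y := by
    have e : y = (Aᵀ * C - Cᵀ * A) * x + (Aᵀ * D - Cᵀ * B) * y := by
      rw [h3, h1]; simp
    have e2 : y = Aᵀ * (C * x + D * y) - Cᵀ * (A * x + B * y) := by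
      refine e.trans ?_
      noncomm_ring
    rw [h0, ← hY] at e2
    simpa using e2
  have ext : xᵀ = -(Yᵀ * B) := by rw [ex]; simp
  have eyt : yᵀ = Yᵀ * A := by rw [ey]; simp
  have eM : Mt = Yᵀ * R := by
    rw [hMt, ext, eyt, hR]; noncomm_ring
  have uYt : IsUnit Yᵀ := by
    rw [Matrix.isUnit_iff_isUnit_det] at uY ⊢
    rwa [Matrix.det_transpose]
  have dR := (Matrix.isUnit_iff_isUnit_det _).1 uR
  have dY := (Matrix.isUnit_iff_isUnit_det _).1 uYt
  have key : ∀ X Z : Matrix (Fin g) (Fin g) ℝ, (X * R) * Mt⁻¹ * (Yᵀ * Z) = X * Z := by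
    intro X Z
    rw [eM, Matrix.mul_inv_rev]
    calc (X * R) * (R⁻¹ * Yᵀ⁻¹) * (Yᵀ * Z) = X * (R * R⁻¹) * (Yᵀ⁻¹ * Yᵀ) * Z := by
          simp only [Matrix.mul_assoc]
      _ = X * Z := by
          rw [Matrix.mul_nonsing_inv _ dR, Matrix.nonsing_inv_mul _ dY]; simp
  refine ⟨eM ▸ uYt.mul uR, ?_, ?_, ?_⟩
  · rw [eb, eyt, key, sub_mul, smul_sub, Matrix.smul_mul, smul_smul]; norm_num
  · rw [eb, ext, Matrix.mul_neg, key, sub_mul, smul_neg, smul_sub, Matrix.smul_mul, smul_smul]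
    norm_num
  · rw [ea, ext, Matrix.mul_neg, key, sub_mul, smul_neg, smul_sub, Matrix.smul_mul, smul_smul]
    norm_num

theorem re_mul_aux {g : ℕ} (A : Matrix (Fin g) (Fin g) ℤ) (P : Matrix (Fin g) (Fin g) ℂ) :
    (A.map (Int.cast : ℤ → ℂ) * P).map Complex.re
      = A.map (Int.cast : ℤ → ℝ) * P.map Complex.re := by
  ext i j
  simp [Matrix.mul_apply]

theorem im_mul_aux {g : ℕ} (A : Matrix (Fin g) (Fin g) ℤ) (P : Matrix (Fin g) (Fin g) ℂ) :
    (A.map (Int.cast : ℤ → ℂ) * P).map Complex.im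
      = A.map (Int.cast : ℤ → ℝ) * P.map Complex.im := by
  ext i j
  simp [Matrix.mul_apply]

theorem cast_mul_aux {g : ℕ} (A B : Matrix (Fin g) (Fin g) ℤ) :
    (A * B).map (Int.cast : ℤ → ℝ) = A.map (Int.cast : ℤ → ℝ) * B.map (Int.cast : ℤ → ℝ) := by
  ext i j
  simp [Matrix.mul_apply]

/-- Under the same hypotheses as Statement 10, the matrix
M̃ := Im(P̃_Bᵀ)·Re(P̃_A) − Im(P̃_Aᵀ)·Re(P̃_B) is invertible and
2CᵀA = AᵀHA − 2·Re(P̃_B)·M̃⁻¹·Im(P̃_Bᵀ),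
2CᵀB = AᵀHB + 2·Re(P̃_B)·M̃⁻¹·Im(P̃_Aᵀ),
2DᵀB = BᵀHB − 2·Re(P̃_A)·M̃⁻¹·Im(P̃_Aᵀ). -/
theorem stmt_11 (g : ℕ) (hg : 1 ≤ g)
    (H A B C D : Matrix (Fin g) (Fin g) ℤ)
    (hsymp : (Matrix.fromBlocks A B C D)ᵀ * Matrix.fromBlocks 0 1 (-1) 0 *
        Matrix.fromBlocks A B C D = (Matrix.fromBlocks 0 1 (-1) 0 :
        Matrix (Fin g ⊕ Fin g) (Fin g ⊕ Fin g) ℤ))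
    (PtA PtB PA PB : Matrix (Fin g) (Fin g) ℂ)
    (hPA : PA = A.map (Int.cast : ℤ → ℂ) * PtA + B.map (Int.cast : ℤ → ℂ) * PtB)
    (hPB : PB = C.map (Int.cast : ℤ → ℂ) * PtA + D.map (Int.cast : ℤ → ℂ) * PtB)
    (hPAreal : ∀ i j, (PA i j).im = 0)
    (hPAinv : IsUnit PA)
    (hRePB : PB.map Complex.re =
      (1 / 2 : ℝ) • (H.map (Int.cast : ℤ → ℝ) * PA.map Complex.re))
    (hImPB : IsUnit (PB.map Complex.im))
    (Mt : Matrix (Fin g) (Fin g) ℝ)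
    (hMt : Mt = (PtBᵀ).map Complex.im * PtA.map Complex.re -
      (PtAᵀ).map Complex.im * PtB.map Complex.re) :
    IsUnit Mt ∧
    (2 : ℝ) • ((C.map (Int.cast : ℤ → ℝ))ᵀ * A.map (Int.cast : ℤ → ℝ)) =
      (A.map (Int.cast : ℤ → ℝ))ᵀ * H.map (Int.cast : ℤ → ℝ) * A.map (Int.cast : ℤ → ℝ) -
        (2 : ℝ) • (PtB.map Complex.re * Mt⁻¹ * (PtBᵀ).map Complex.im) ∧
    (2 : ℝ) • ((C.map (Int.cast : ℤ → ℝ))ᵀ * B.map (Int.cast : ℤ → ℝ)) =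
      (A.map (Int.cast : ℤ → ℝ))ᵀ * H.map (Int.cast : ℤ → ℝ) * B.map (Int.cast : ℤ → ℝ) +
        (2 : ℝ) • (PtB.map Complex.re * Mt⁻¹ * (PtAᵀ).map Complex.im) ∧
    (2 : ℝ) • ((D.map (Int.cast : ℤ → ℝ))ᵀ * B.map (Int.cast : ℤ → ℝ)) =
      (B.map (Int.cast : ℤ → ℝ))ᵀ * H.map (Int.cast : ℤ → ℝ) * B.map (Int.cast : ℤ → ℝ) -
        (2 : ℝ) • (PtA.map Complex.re * Mt⁻¹ * (PtAᵀ).map Complex.im) := by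
  rw [Matrix.fromBlocks_transpose, Matrix.fromBlocks_multiply, Matrix.fromBlocks_multiply,
    Matrix.fromBlocks_inj] at hsymp
  simp only [mul_zero, mul_one, zero_add, add_zero, mul_neg, neg_mul] at hsymp
  obtain ⟨s1, s2, -, s4⟩ := hsymp
  have t1 : Aᵀ * C = Cᵀ * A := by rw [← sub_eq_zero, ← s1]; abel
  have t2 : Bᵀ * D = Dᵀ * B := by rw [← sub_eq_zero, ← s4]; abel
  have t3 : Aᵀ * D = 1 + Cᵀ * B := by rw [← s2]; abel
  have hre : PA.map Complex.re = A.map (Int.cast : ℤ → ℝ) * PtA.map Complex.re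
      + B.map (Int.cast : ℤ → ℝ) * PtB.map Complex.re := by
    rw [hPA, ← re_mul_aux, ← re_mul_aux]; ext i j; simp
  refine aux_real (H.map (Int.cast : ℤ → ℝ)) (A.map (Int.cast : ℤ → ℝ))
    (B.map (Int.cast : ℤ → ℝ)) (C.map (Int.cast : ℤ → ℝ)) (D.map (Int.cast : ℤ → ℝ))
    (PtA.map Complex.re) (PtB.map Complex.re) (PtA.map Complex.im) (PtB.map Complex.im)
    (PA.map Complex.re) (PB.map Complex.im) Mt ?_ ?_ ?_ hre ?_ ?_ ?_ ?_ hImPB hMt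
  · rw [← Matrix.transpose_map, ← Matrix.transpose_map, ← cast_mul_aux, ← cast_mul_aux, t1]
  · rw [← Matrix.transpose_map, ← Matrix.transpose_map, ← cast_mul_aux, ← cast_mul_aux, t2]
  · rw [← Matrix.transpose_map, ← Matrix.transpose_map, ← cast_mul_aux, ← cast_mul_aux, t3]
    ext i j
    simp [Matrix.one_apply]
  · rw [← im_mul_aux, ← im_mul_aux]
    ext i j
    have := hPAreal i j
    rw [hPA] at this
    simpa using this
  · rw [← hRePB, hPB, ← re_mul_aux, ← re_mul_aux]; ext i j; simp
  · rw [hPB, ← im_mul_aux, ← im_mul_aux]; ext i j; simp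
  · have e : PA = (PA.map Complex.re).map Complex.ofRealHom := by
      ext i j
      apply Complex.ext
      · simp
      · simpa using hPAreal i j
    rw [Matrix.isUnit_iff_isUnit_det, isUnit_iff_ne_zero] at hPAinv ⊢
    intro h
    apply hPAinv
    rw [e]
    have := (RingHom.map_det Complex.ofRealHom (PA.map Complex.re)).symm
    rw [RingHom.mapMatrix_apply] at this
    rw [this, h, map_zero]
end
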